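/- arXiv:1510.06394 — 3 statements merged into one kernel-verified Lean document; each statement's English description precedes it below -/
import Mathlib

section
/- Let F : S(n) → ℝ be uniformly elliptic with constants 0 < λ ≤ Λ and F(0) = 0. Let c ≥ 0 and let M ∈ S(n) satisfy M + cI positive semidefinite (i.e. M ≥ −cI) and F(M) ≤ 0. Then, with M = M⁺ − M⁻ the decomposition into positive and negative parts, ‖M⁻‖ ≤ c and λ‖M⁺‖ ≤ Λ‖M⁻‖; consequently ‖M‖ ≤ (Λ/λ)·c. (This is the pointwise form of the fact that a semiconvex supersolution of a uniformly elliptic equation has bounded Hessian, i.e. is C^{1,1}.) -/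
open MeasureTheory Metric Set
open scoped RealInnerProductSpace

noncomputable section

/-- Euclidean space ℝⁿ. -/
abbrev Euc (n : ℕ) := EuclideanSpace ℝ (Fin n)

/-- The operator norm of an `n × n` real matrix, viewed as a linear map on ℝⁿ. -/
def opNorm {n : ℕ} (A : Matrix (Fin n) (Fin n) ℝ) : ℝ :=
  ‖Matrix.toEuclideanCLM (𝕜 := ℝ) A‖

/-- The Hessian matrix `D²u(x)` of `u : ℝⁿ → ℝ` at `x`. -/
def hess2 {n : ℕ} (u : Euc n → ℝ) (x : Euc n) : Matrix (Fin n) (Fin n) ℝ :=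
  fun i j => iteratedFDeriv ℝ 2 u x ![EuclideanSpace.single i 1, EuclideanSpace.single j 1]

/-- `F` is uniformly elliptic with ellipticity constants `0 < lb ≤ ub`:
`lb‖P‖ ≤ F(A+P) − F(A) ≤ ub‖P‖` for all symmetric `A` and positive semidefinite `P`. -/
def UniformlyElliptic {n : ℕ} (F : Matrix (Fin n) (Fin n) ℝ → ℝ) (lb ub : ℝ) : Prop :=
  ∀ (A P : Matrix (Fin n) (Fin n) ℝ), A.IsSymm → P.PosSemidef →
    lb * opNorm P ≤ F (A + P) - F A ∧ F (A + P) - F A ≤ ub * opNorm P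

/-- `u` is a viscosity supersolution of `F(D²u) ≤ 0` in `U`: every C² test function
touching `u` from below at a point of `U` satisfies `F(D²ψ(x₀)) ≤ 0`. -/
def ViscSupersol {n : ℕ} (F : Matrix (Fin n) (Fin n) ℝ → ℝ) (U : Set (Euc n))
    (u : Euc n → ℝ) : Prop :=
  ∀ x₀ ∈ U, ∀ ψ : Euc n → ℝ, ContDiff ℝ 2 ψ → ψ x₀ = u x₀ →
    (∀ᶠ x in nhds x₀, ψ x ≤ u x) → F (hess2 ψ x₀) ≤ 0

/-- `u` is a viscosity subsolution of `F(D²u) ≥ 0` in `U`: every C² test function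
touching `u` from above at a point of `U` satisfies `F(D²ψ(x₀)) ≥ 0`. -/
def ViscSubsol {n : ℕ} (F : Matrix (Fin n) (Fin n) ℝ → ℝ) (U : Set (Euc n))
    (u : Euc n → ℝ) : Prop :=
  ∀ x₀ ∈ U, ∀ ψ : Euc n → ℝ, ContDiff ℝ 2 ψ → ψ x₀ = u x₀ →
    (∀ᶠ x in nhds x₀, u x ≤ ψ x) → 0 ≤ F (hess2 ψ x₀)

/-- `u` solves the fully nonlinear obstacle problem in `Ω` with obstacle `φ`:
`u ∈ C(Ω)`, `u ≥ φ` in `Ω`, `u` is a viscosity supersolution of `F(D²u) ≤ 0` in `Ω`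
and a viscosity solution of `F(D²u) = 0` in the non-contact set `{u > φ}`. -/
def SolvesObstacle {n : ℕ} (F : Matrix (Fin n) (Fin n) ℝ → ℝ) (Ω : Set (Euc n))
    (u φ : Euc n → ℝ) : Prop :=
  ContinuousOn u Ω ∧ (∀ x ∈ Ω, φ x ≤ u x) ∧ ViscSupersol F Ω u ∧
  ViscSupersol F {x ∈ Ω | φ x < u x} u ∧ ViscSubsol F {x ∈ Ω | φ x < u x} u

/-- A modulus: `ω : [0,∞) → [0,∞)` nondecreasing with `ω(0) = 0`. -/
def IsModulus (ω : ℝ → ℝ) : Prop :=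
  ω 0 = 0 ∧ MonotoneOn ω (Ici 0) ∧ ∀ r, 0 ≤ r → 0 ≤ ω r

/-- `φ` is semiconvex on `Ω` with modulus of semiconvexity `ω`: at every `x₀ ∈ Ω` there is
a slope `p` with `φ(x) ≥ φ(x₀) + ⟨p, x − x₀⟩ − ω(|x − x₀|)` on `Ω`. -/
def SemiconvexWithModulus {n : ℕ} (Ω : Set (Euc n)) (φ : Euc n → ℝ) (ω : ℝ → ℝ) : Prop :=
  ∀ x₀ ∈ Ω, ∃ p : Euc n, ∀ x ∈ Ω, φ x₀ + ⟪p, x - x₀⟫ - ω ‖x - x₀‖ ≤ φ x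

/-- `p` is the slope of a linear part of `φ` at `x₀` (for modulus `ω`). -/
def IsLinearPartSlope {n : ℕ} (Ω : Set (Euc n)) (φ : Euc n → ℝ) (ω : ℝ → ℝ)
    (x₀ : Euc n) (p : Euc n) : Prop :=
  ∀ x ∈ Ω, φ x₀ + ⟪p, x - x₀⟫ - ω ‖x - x₀‖ ≤ φ x

/-- `g` is semiconcave with modulus `ω` on `s`. -/
def SemiconcaveWithModulus {n : ℕ} (s : Set (Euc n)) (g : Euc n → ℝ) (ω : ℝ → ℝ) : Prop :=
  ∀ x h : Euc n, x ∈ s → x + h ∈ s → x - h ∈ s →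
    g (x + h) + g (x - h) - 2 * g x ≤ ω ‖h‖

/-- Componentwise order `x ≤ y` on ℝⁿ (`y − x` in the positive cone). -/
def coneLE {n : ℕ} (x y : Euc n) : Prop := ∀ i, x i ≤ y i

/-- The intervention operator `Mu(x) = φ(x) + inf{ u(y) : y ∈ D, y ≥ x }`. -/
def Mop {n : ℕ} (D : Set (Euc n)) (φ u : Euc n → ℝ) (x : Euc n) : ℝ :=
  φ x + sInf (u '' {y ∈ D | coneLE x y})

/-- A bounded domain with `C^{2,α}` boundary, via a global `C^{2,α}` defining function. -/
def IsC2AlphaDomain {n : ℕ} (Ω : Set (Euc n)) (α : ℝ) : Prop :=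
  ∃ ρ : Euc n → ℝ, ContDiff ℝ 2 ρ ∧ Ω = {x | ρ x < 0} ∧
    (∀ x ∈ frontier Ω, fderiv ℝ ρ x ≠ 0) ∧
    ∃ C : ℝ, 0 ≤ C ∧ ∀ x y : Euc n,
      ‖iteratedFDeriv ℝ 2 ρ x - iteratedFDeriv ℝ 2 ρ y‖ ≤ C * ‖x - y‖ ^ α

/-- `u` is a continuous viscosity solution of the fully nonlinear stochastic impulse
control problem on `Ω` with obstacle `Mu` built from `φ`: `u ∈ C(Ω̄)`, `u ≤ Mu` in `Ω`,
`u` is a viscosity subsolution of `F(D²u) ≥ 0` in `Ω`, a viscosity solution of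
`F(D²u) = 0` in `{u < Mu}`, `u = 0` on `∂Ω` and `u ≤ 0` on `Ω̄`. -/
def SolvesImpulse {n : ℕ} (F : Matrix (Fin n) (Fin n) ℝ → ℝ) (Ω : Set (Euc n))
    (u φ : Euc n → ℝ) : Prop :=
  ContinuousOn u (closure Ω) ∧
  (∀ x ∈ Ω, u x ≤ Mop (closure Ω) φ u x) ∧
  ViscSubsol F Ω u ∧
  ViscSubsol F {x ∈ Ω | u x < Mop (closure Ω) φ u x} u ∧
  ViscSupersol F {x ∈ Ω | u x < Mop (closure Ω) φ u x} u ∧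
  (∀ x ∈ frontier Ω, u x = 0) ∧ (∀ x ∈ closure Ω, u x ≤ 0)

/-- A symmetric operator on a finite-dimensional real inner product space whose eigenvalues are
all at most `r` in absolute value has norm at most `r`. -/
theorem norm_le_of_forall_eigenvalue_abs_le {E : Type*} [NormedAddCommGroup E]
    [InnerProductSpace ℝ E] [FiniteDimensional ℝ E] {T : E →L[ℝ] E}
    (hT : (T : E →ₗ[ℝ] E).IsSymmetric) {r : ℝ} (hr : 0 ≤ r)
    (h : ∀ (μ : ℝ) (v : E), ‖v‖ = 1 → T v = μ • v → |μ| ≤ r) : ‖T‖ ≤ r := by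
  refine T.opNorm_le_bound hr fun x => ?_
  refine (sq_le_sq₀ (norm_nonneg _) (by positivity)).mp ?_
  set b := hT.eigenvectorBasis rfl
  have hb (i) : T (b i) = hT.eigenvalues rfl i • b i := hT.apply_eigenvectorBasis rfl i
  rw [mul_pow, ← b.sum_sq_norm_inner_right (T x), ← b.sum_sq_norm_inner_right x, Finset.mul_sum]
  refine Finset.sum_le_sum fun i _ => ?_
  have hi : ⟪b i, T x⟫ = hT.eigenvalues rfl i * ⟪b i, x⟫ := by
    rw [← real_inner_smul_left, ← hb i]
    exact (hT (b i) x).symm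
  rw [hi, norm_mul, mul_pow]
  gcongr
  exact h _ _ (b.norm_eq_one i) (hb i)

theorem Matrix.PosSemidef.inner_toEuclideanCLM_nonneg {n : ℕ} {A : Matrix (Fin n) (Fin n) ℝ}
    (hA : A.PosSemidef) (x : Euc n) : 0 ≤ ⟪Matrix.toEuclideanCLM (𝕜 := ℝ) A x, x⟫ :=
  (Matrix.isPositive_toEuclideanLin_iff.mpr hA).re_inner_nonneg_left x

theorem opNorm_le_of_forall_eigenvalue_abs_le {n : ℕ} {A : Matrix (Fin n) (Fin n) ℝ}
    (hA : A.IsHermitian) {r : ℝ} (hr : 0 ≤ r)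
    (h : ∀ (μ : ℝ) (v : Euc n), ‖v‖ = 1 → Matrix.toEuclideanCLM (𝕜 := ℝ) A v = μ • v → |μ| ≤ r) :
    opNorm A ≤ r :=
  norm_le_of_forall_eigenvalue_abs_le (Matrix.isSymmetric_toEuclideanLin_iff.mpr hA) hr h

theorem inner_toEuclideanCLM_le_opNorm {n : ℕ} (A : Matrix (Fin n) (Fin n) ℝ) {v : Euc n}
    (hv : ‖v‖ = 1) : ⟪Matrix.toEuclideanCLM (𝕜 := ℝ) A v, v⟫ ≤ opNorm A := by
  have h := (real_inner_le_norm (Matrix.toEuclideanCLM (𝕜 := ℝ) A v) v).trans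
    (mul_le_mul_of_nonneg_right ((Matrix.toEuclideanCLM (𝕜 := ℝ) A).le_opNorm v) (norm_nonneg v))
  simpa [hv, opNorm] using h

theorem inner_eq_of_apply_eq_smul {n : ℕ} {A : Matrix (Fin n) (Fin n) ℝ} {μ : ℝ} {v : Euc n}
    (hv : ‖v‖ = 1) (h : Matrix.toEuclideanCLM (𝕜 := ℝ) A v = μ • v) :
    ⟪Matrix.toEuclideanCLM (𝕜 := ℝ) A v, v⟫ = μ := by
  rw [h, real_inner_smul_left, real_inner_self_eq_norm_sq, hv]
  simp

theorem neg_le_inner_of_posSemidef_add_smul_one {n : ℕ} {M : Matrix (Fin n) (Fin n) ℝ} {c : ℝ}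
    (hMc : (M + c • (1 : Matrix (Fin n) (Fin n) ℝ)).PosSemidef) {v : Euc n} (hv : ‖v‖ = 1) :
    -c ≤ ⟪Matrix.toEuclideanCLM (𝕜 := ℝ) M v, v⟫ := by
  have h := hMc.inner_toEuclideanCLM_nonneg v
  simp only [map_add, map_smul, map_one, add_apply, smul_apply, one_apply_eq_self,
    inner_add_left, real_inner_smul_left, real_inner_self_eq_norm_sq, hv] at h
  linarith

/-- If `M = Mp - Mn` with `Mp`, `Mn` positive semidefinite and `Mp * Mn = 0`, then `M ⪰ -cI`
forces `‖Mn‖ ≤ c`. -/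
theorem opNorm_negPart_le {n : ℕ} {M Mp Mn : Matrix (Fin n) (Fin n) ℝ} {c : ℝ} (hc : 0 ≤ c)
    (hMc : (M + c • (1 : Matrix (Fin n) (Fin n) ℝ)).PosSemidef) (hn : Mn.PosSemidef)
    (hsub : M = Mp - Mn) (hmul : Mp * Mn = 0) : opNorm Mn ≤ c := by
  refine opNorm_le_of_forall_eigenvalue_abs_le hn.isHermitian hc fun μ v hv h => ?_
  have hμ : 0 ≤ μ := inner_eq_of_apply_eq_smul hv h ▸ hn.inner_toEuclideanCLM_nonneg v
  rw [abs_of_nonneg hμ]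
  rcases hμ.eq_or_lt with rfl | hpos
  · exact hc
  have hMp : Matrix.toEuclideanCLM (𝕜 := ℝ) Mp v = 0 := by
    have h0 : Matrix.toEuclideanCLM (𝕜 := ℝ) (Mp * Mn) v = 0 := by simp [hmul]
    rw [map_mul, mul_apply_eq_comp, h, map_smul] at h0
    exact (smul_eq_zero.mp h0).resolve_left hpos.ne'
  have hM : Matrix.toEuclideanCLM (𝕜 := ℝ) M v = (-μ) • v := by
    rw [hsub, map_sub, sub_apply, hMp, h, zero_sub, neg_smul]
  have := neg_le_inner_of_posSemidef_add_smul_one hMc hv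
  rw [inner_eq_of_apply_eq_smul hv hM] at this
  linarith

theorem UniformlyElliptic.opNorm_posPart_le {n : ℕ} {F : Matrix (Fin n) (Fin n) ℝ → ℝ}
    {lb ub : ℝ} (hF : UniformlyElliptic F lb ub) (hF0 : F 0 = 0)
    {M Mp Mn : Matrix (Fin n) (Fin n) ℝ} (hM : M.IsSymm) (hFM : F M ≤ 0) (hp : Mp.PosSemidef)
    (hn : Mn.PosSemidef) (hsub : M = Mp - Mn) : lb * opNorm Mp ≤ ub * opNorm Mn := by
  have h1 := (hF 0 Mp Matrix.isSymm_zero hp).1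
  have h2 := (hF M Mn hM hn).2
  rw [zero_add, hF0] at h1
  rw [hsub, sub_add_cancel, ← hsub] at h2
  linarith

open scoped MatrixOrder in
theorem Matrix.IsHermitian.exists_posSemidef_sub {n : ℕ} {M : Matrix (Fin n) (Fin n) ℝ}
    (hM : M.IsHermitian) : ∃ Mp Mn : Matrix (Fin n) (Fin n) ℝ,
      Mp.PosSemidef ∧ Mn.PosSemidef ∧ M = Mp - Mn ∧ Mp * Mn = 0 :=
  ⟨M⁺, M⁻, Matrix.nonneg_iff_posSemidef.mp (CFC.posPart_nonneg M),
    Matrix.nonneg_iff_posSemidef.mp (CFC.negPart_nonneg M),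
    (CFC.posPart_sub_negPart M hM).symm, CFC.posPart_mul_negPart M⟩

/-- Pointwise form of the `C^{1,1}` estimate: if `M ⪰ −cI` and
`F(M) ≤ 0` then `‖M⁻‖ ≤ c`, `λ‖M⁺‖ ≤ Λ‖M⁻‖` and `‖M‖ ≤ (Λ/λ)c`. -/
theorem semiconvex_supersolution_pointwise_hessian_bound
    (n : ℕ) (lb ub c : ℝ) (hlb : 0 < lb) (hle : lb ≤ ub) (hc : 0 ≤ c)
    (F : Matrix (Fin n) (Fin n) ℝ → ℝ) (hF : UniformlyElliptic F lb ub) (hF0 : F 0 = 0)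
    (M : Matrix (Fin n) (Fin n) ℝ) (hM : M.IsSymm)
    (hMc : (M + c • (1 : Matrix (Fin n) (Fin n) ℝ)).PosSemidef)
    (hFM : F M ≤ 0) :
    (∀ Mp Mn : Matrix (Fin n) (Fin n) ℝ, Mp.PosSemidef → Mn.PosSemidef →
      M = Mp - Mn → Mp * Mn = 0 →
      opNorm Mn ≤ c ∧ lb * opNorm Mp ≤ ub * opNorm Mn) ∧
    opNorm M ≤ (ub / lb) * c := by
  have key : ∀ Mp Mn : Matrix (Fin n) (Fin n) ℝ, Mp.PosSemidef → Mn.PosSemidef →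
      M = Mp - Mn → Mp * Mn = 0 →
      opNorm Mn ≤ c ∧ lb * opNorm Mp ≤ ub * opNorm Mn := fun Mp Mn hp hn hsub hmul =>
    ⟨opNorm_negPart_le hc hMc hn hsub hmul, hF.opNorm_posPart_le hF0 hM hFM hp hn hsub⟩
  refine ⟨key, ?_⟩
  have hH : M.IsHermitian := by
    rw [Matrix.IsHermitian, Matrix.conjTranspose_eq_transpose_of_trivial, hM]
  obtain ⟨Mp, Mn, hp, hn, hsub, hmul⟩ := hH.exists_posSemidef_sub
  obtain ⟨hnc, hpn⟩ := key Mp Mn hp hn hsub hmul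
  have hub : 0 ≤ ub := hlb.le.trans hle
  have hpc : opNorm Mp ≤ ub / lb * c := by
    rw [div_mul_eq_mul_div, le_div_iff₀ hlb, mul_comm]
    exact hpn.trans (mul_le_mul_of_nonneg_left hnc hub)
  have hcc : c ≤ ub / lb * c := le_mul_of_one_le_left hc ((one_le_div hlb).mpr hle)
  refine opNorm_le_of_forall_eigenvalue_abs_le hH (hc.trans hcc) fun μ v hv h => ?_
  rw [← inner_eq_of_apply_eq_smul hv h, abs_le]
  refine ⟨(neg_le_neg hcc).trans (neg_le_inner_of_posSemidef_add_smul_one hMc hv), ?_⟩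
  have h1 := inner_toEuclideanCLM_le_opNorm Mp hv
  have h2 := hn.inner_toEuclideanCLM_nonneg v
  rw [hsub, map_sub, sub_apply, inner_sub_left]
  linarith
end
end

section
/- Let Ω ⊂ ℝⁿ be a bounded open set, F : S(n) → ℝ uniformly elliptic with constants 0 < λ ≤ Λ and F(0) = 0, and let ψ ∈ C²(Ω̄) satisfy D²ψ(x) + c₀I positive semidefinite for all x ∈ Ω (for some c₀ ≥ 0) and ψ < 0 on ∂Ω. Let β ∈ C¹(ℝ) be strictly increasing (β′ > 0), and let u ∈ C²(Ω) ∩ C(Ω̄) solve the penalized problem F(D²u(x)) = β(u(x) − ψ(x)) in Ω with u = 0 on ∂Ω. Then β(u(x) − ψ(x)) ≥ min{ β(0), −Λ·c₀ } for all x ∈ Ω̄; in particular the penalization term is bounded below independently of the particular β. -/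
open MeasureTheory Metric Set
open scoped RealInnerProductSpace

noncomputable section

section SecondOrderCondition

variable {E : Type*} [NormedAddCommGroup E] [NormedSpace ℝ E]

theorem ContDiffAt.differentiableAt_fderiv_of_two {w : E → ℝ} {x : E} (hw : ContDiffAt ℝ 2 w x) :
    DifferentiableAt ℝ (fderiv ℝ w) x :=
  (hw.fderiv_right (m := 1) (by norm_num)).differentiableAt (by norm_num)

/-- A `C²` function has nonnegative second derivative at a local minimum. -/
theorem IsLocalMin.fderiv_fderiv_nonneg {w : E → ℝ} {x : E} (h : IsLocalMin w x)
    (hw : ContDiffAt ℝ 2 w x) (v : E) : 0 ≤ fderiv ℝ (fderiv ℝ w) x v v := by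
  have hline (t : ℝ) : HasDerivAt (fun s : ℝ => x + s • v) v t := by
    simpa using ((hasDerivAt_id t).smul_const v).const_add x
  have htend : Filter.Tendsto (fun s : ℝ => x + s • v) (nhds 0) (nhds x) := by
    simpa using (hline 0).continuousAt.tendsto
  set g : ℝ → ℝ := fun s => w (x + s • v) with hg
  have hdiff : ∀ᶠ y in nhds x, DifferentiableAt ℝ w y :=
    (hw.eventually (by simp)).mono fun y hy => hy.differentiableAt (by norm_num)
  have hderiv : deriv g =ᶠ[nhds 0] fun s => fderiv ℝ w (x + s • v) v := by
    filter_upwards [htend.eventually hdiff] with s hs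
    exact (hs.hasFDerivAt.comp_hasDerivAt s (hline s)).deriv
  have hderiv2 : deriv (deriv g) 0 = fderiv ℝ (fderiv ℝ w) x v v := by
    rw [hderiv.deriv_eq]
    have h1 : HasFDerivAt (fderiv ℝ w) (fderiv ℝ (fderiv ℝ w) x) (x + (0 : ℝ) • v) := by
      simpa using hw.differentiableAt_fderiv_of_two.hasFDerivAt
    have h2 := h1.comp_hasDerivAt (0 : ℝ) (hline 0)
    exact ((ContinuousLinearMap.apply ℝ ℝ v).hasFDerivAt.comp_hasDerivAt (0 : ℝ) h2).deriv
  have hmin : IsLocalMin g 0 := by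
    filter_upwards [htend.eventually h] with s hs
    simpa [hg] using hs
  have hcont : ContinuousAt g 0 := by
    have hx : ContinuousAt w (x + (0 : ℝ) • v) := by simpa using hw.continuousAt
    exact hx.comp (f := fun s : ℝ => x + s • v) (hline 0).continuousAt
  rw [← hderiv2]
  by_contra! hneg
  have hmax := isLocalMax_of_deriv_deriv_neg hneg hmin.deriv_eq_zero hcont
  have hconst : g =ᶠ[nhds 0] fun _ => g 0 := by
    filter_upwards [hmin, hmax] with s h1 h2 using le_antisymm h2 h1
  have hzero : deriv (deriv g) 0 = 0 := by
    rw [hconst.deriv.deriv_eq]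
    simp
  exact hneg.ne hzero

end SecondOrderCondition

section Hessian

variable {n : ℕ} {v w : Euc n → ℝ} {x : Euc n}

theorem hess2_apply (w : Euc n → ℝ) (x : Euc n) (i j : Fin n) :
    hess2 w x i j =
      fderiv ℝ (fderiv ℝ w) x (EuclideanSpace.single i 1) (EuclideanSpace.single j 1) := by
  simp [hess2, iteratedFDeriv_two_apply]

theorem hess2_isSymm (hw : ContDiffAt ℝ 2 w x) : (hess2 w x).IsSymm := by
  ext i j
  rw [Matrix.transpose_apply, hess2_apply, hess2_apply]
  exact hw.isSymmSndFDerivAt (by simp) _ _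

theorem hess2_sub (hv : ContDiffAt ℝ 2 v x) (hw : ContDiffAt ℝ 2 w x) :
    hess2 (fun y => v y - w y) x = hess2 v x - hess2 w x := by
  have h : fderiv ℝ (fun y => v y - w y) =ᶠ[nhds x] fun y => fderiv ℝ v y - fderiv ℝ w y := by
    filter_upwards [hv.eventually (by simp), hw.eventually (by simp)] with y h1 h2
    exact fderiv_fun_sub (h1.differentiableAt (by norm_num)) (h2.differentiableAt (by norm_num))
  ext i j
  rw [Matrix.sub_apply, hess2_apply, hess2_apply, hess2_apply, h.fderiv_eq,
    fderiv_fun_sub hv.differentiableAt_fderiv_of_two hw.differentiableAt_fderiv_of_two]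
  simp

theorem dotProduct_hess2_mulVec (w : Euc n → ℝ) (x : Euc n) (y : Fin n → ℝ) :
    y ⬝ᵥ (hess2 w x).mulVec y =
      fderiv ℝ (fderiv ℝ w) x (WithLp.toLp 2 y) (WithLp.toLp 2 y) := by
  have hy : WithLp.toLp 2 y = ∑ i, y i • (EuclideanSpace.single i (1 : ℝ) : Euc n) := by
    simpa using ((EuclideanSpace.basisFun (Fin n) ℝ).sum_repr (WithLp.toLp 2 y)).symm
  rw [hy]
  simp only [dotProduct, Matrix.mulVec, hess2_apply, Finset.mul_sum, map_sum, map_smul,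
    sum_apply, smul_apply, smul_eq_mul]
  rw [Finset.sum_comm]
  exact Finset.sum_congr rfl fun i _ => Finset.sum_congr rfl fun j _ => by ring

theorem IsLocalMin.posSemidef_hess2 (h : IsLocalMin w x) (hw : ContDiffAt ℝ 2 w x) :
    (hess2 w x).PosSemidef := by
  refine Matrix.PosSemidef.of_dotProduct_mulVec_nonneg ?_ fun y => ?_
  · rw [Matrix.IsHermitian, Matrix.conjTranspose_eq_transpose_of_trivial]
    exact hess2_isSymm hw
  · rw [star_trivial, dotProduct_hess2_mulVec]
    exact h.fderiv_fderiv_nonneg hw _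

end Hessian

theorem opNorm_smul_one_le {n : ℕ} {c : ℝ} (hc : 0 ≤ c) :
    opNorm (c • (1 : Matrix (Fin n) (Fin n) ℝ)) ≤ c := by
  rw [opNorm, map_smul, map_one, norm_smul, Real.norm_of_nonneg hc]
  exact mul_le_of_le_one_right hc ContinuousLinearMap.norm_id_le

/-- A lower bound on the symmetric matrix `A` gives one on `F A`. -/
theorem UniformlyElliptic.neg_mul_le {n : ℕ} {F : Matrix (Fin n) (Fin n) ℝ → ℝ} {lb ub c : ℝ}
    (hF : UniformlyElliptic F lb ub) (hF0 : F 0 = 0) (hlb : 0 ≤ lb) (hub : 0 ≤ ub) (hc : 0 ≤ c)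
    {A : Matrix (Fin n) (Fin n) ℝ}
    (hA : (A + c • (1 : Matrix (Fin n) (Fin n) ℝ)).PosSemidef) : -(ub * c) ≤ F A := by
  have hsymm : (-(c • (1 : Matrix (Fin n) (Fin n) ℝ))).IsSymm := by
    simp [Matrix.IsSymm]
  have h1 := (hF _ _ hsymm hA).1
  have h2 := (hF _ _ hsymm (Matrix.PosSemidef.one.smul hc)).2
  rw [neg_add_cancel_comm_assoc] at h1
  rw [neg_add_cancel, hF0] at h2
  have h3 : 0 ≤ lb * opNorm (A + c • (1 : Matrix (Fin n) (Fin n) ℝ)) :=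
    mul_nonneg hlb (norm_nonneg _)
  have h4 := mul_le_mul_of_nonneg_left (opNorm_smul_one_le (n := n) hc) hub
  linarith

/-- Uniform lower bound for the penalization term of the penalized
obstacle problem, independent of the particular `β`. -/
theorem penalization_term_bounded_below
    (n : ℕ) (lb ub c₀ : ℝ) (hlb : 0 < lb) (hle : lb ≤ ub) (hc₀ : 0 ≤ c₀)
    (F : Matrix (Fin n) (Fin n) ℝ → ℝ) (hF : UniformlyElliptic F lb ub) (hF0 : F 0 = 0)
    (Ω : Set (Euc n)) (hΩo : IsOpen Ω) (hΩb : Bornology.IsBounded Ω)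
    (ψ : Euc n → ℝ) (hψc : ContinuousOn ψ (closure Ω))
    (hψ2 : ∀ x ∈ Ω, ContDiffAt ℝ 2 ψ x)
    (hψsc : ∀ x ∈ Ω, (hess2 ψ x + c₀ • (1 : Matrix (Fin n) (Fin n) ℝ)).PosSemidef)
    (hψneg : ∀ x ∈ frontier Ω, ψ x < 0)
    (β : ℝ → ℝ) (hβ : ContDiff ℝ 1 β) (hβ' : ∀ t : ℝ, 0 < deriv β t)
    (u : Euc n → ℝ) (huc : ContinuousOn u (closure Ω))
    (hu2 : ∀ x ∈ Ω, ContDiffAt ℝ 2 u x)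
    (hpde : ∀ x ∈ Ω, F (hess2 u x) = β (u x - ψ x))
    (hbc : ∀ x ∈ frontier Ω, u x = 0) :
    ∀ x ∈ closure Ω, min (β 0) (-(ub * c₀)) ≤ β (u x - ψ x) := by
  intro x hx
  have hmono : Monotone β := (strictMono_of_deriv_pos hβ').monotone
  have hcont : ContinuousOn (fun y => u y - ψ y) (closure Ω) := huc.sub hψc
  obtain ⟨x₀, hx₀, hmin⟩ := hΩb.isCompact_closure.exists_isMinOn ⟨x, hx⟩ hcont
  refine le_trans ?_ (hmono (hmin hx))
  by_cases hx₀Ω : x₀ ∈ Ω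
  · refine (min_le_right _ _).trans ?_
    rw [← hpde x₀ hx₀Ω]
    have hloc : IsLocalMin (fun y => u y - ψ y) x₀ :=
      hmin.isLocalMin (Filter.mem_of_superset (hΩo.mem_nhds hx₀Ω) subset_closure)
    have hpos := hloc.posSemidef_hess2 ((hu2 x₀ hx₀Ω).sub (hψ2 x₀ hx₀Ω))
    rw [hess2_sub (hu2 x₀ hx₀Ω) (hψ2 x₀ hx₀Ω)] at hpos
    refine hF.neg_mul_le hF0 hlb.le (hlb.le.trans hle) hc₀ ?_
    simpa [← add_assoc] using hpos.add (hψsc x₀ hx₀Ω)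
  · have hfr : x₀ ∈ frontier Ω := by
      rw [hΩo.frontier_eq]
      exact ⟨hx₀, hx₀Ω⟩
    refine (min_le_left _ _).trans (hmono ?_)
    linarith [hψneg x₀ hfr, hbc x₀ hfr]
end
end

section
/- Let Ω ⊂ ℝⁿ be a bounded open set, let F : S(n) → ℝ be C², convex, and uniformly elliptic with constants 0 < λ ≤ Λ. Let ψ ∈ C²(Ω) satisfy ⟨D²ψ(x)τ, τ⟩ ≥ −c₀ for all x ∈ Ω and all unit vectors τ (for some c₀ ≥ 0). Let β ∈ C²(ℝ) with β′ > 0 and β″ ≤ 0, and let u ∈ C⁴(Ω) ∩ C²(Ω̄) solve F(D²u) = β(u − ψ) in Ω. Then for every unit vector τ the pure second derivative u_{ττ} = ⟨D²u τ, τ⟩ satisfies inf_Ω u_{ττ} ≥ min{ inf_{∂Ω} u_{ττ}, −c₀ }; in particular, if the boundary values of the second derivatives are bounded below by −C independently of the penalization, then u is semiconvex with linear modulus max{C, c₀} uniformly in the penalization. -/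
open MeasureTheory Metric Set
open scoped RealInnerProductSpace

noncomputable section

attribute [local instance] Matrix.frobeniusNormedAddCommGroup Matrix.frobeniusNormedSpace

section DirectionalDerivative

variable {E G : Type*} [NormedAddCommGroup E] [NormedSpace ℝ E]
  [NormedAddCommGroup G] [NormedSpace ℝ G]

/-- The directional derivative of `f` in the direction `v`. -/
def dirDeriv (v : E) (f : E → G) (x : E) : G := fderiv ℝ f x v

theorem ContDiffAt.dirDeriv {m n : ℕ∞} {f : E → G} {x : E} (v : E)
    (hf : ContDiffAt ℝ n f x) (h : m + 1 ≤ n) : ContDiffAt ℝ m (dirDeriv v f) x :=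
  (hf.fderiv_right (m := m) (mod_cast h)).clm_apply contDiffAt_const

theorem Filter.EventuallyEq.dirDeriv {f g : E → G} {x : E} (v : E) (h : f =ᶠ[nhds x] g) :
    dirDeriv v f =ᶠ[nhds x] dirDeriv v g := by
  filter_upwards [h.fderiv (𝕜 := ℝ)] with y hy
  simp only [_root_.dirDeriv, hy]

theorem fderiv_dirDeriv_apply {f : E → G} {x : E} (v w : E)
    (hf : DifferentiableAt ℝ (fderiv ℝ f) x) :
    fderiv ℝ (dirDeriv v f) x w = fderiv ℝ (fderiv ℝ f) x w v := by
  have h : HasFDerivAt (dirDeriv v f) ((fderiv ℝ (fderiv ℝ f) x).flip v) x := by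
    simpa [funext_iff, show dirDeriv v f = fun y => fderiv ℝ f y v from rfl] using hf.hasFDerivAt.clm_apply (hasFDerivAt_const v x)
  rw [h.fderiv, ContinuousLinearMap.flip_apply]

theorem fderiv_dirDeriv_eventuallyEq {n : ℕ∞} {f : E → G} {x : E} (v : E)
    (hf : ContDiffAt ℝ n f x) (hn : 2 ≤ n) :
    fderiv ℝ (dirDeriv v f) =ᶠ[nhds x] dirDeriv v (fderiv ℝ f) := by
  have h2 : ContDiffAt ℝ 2 f x := hf.of_le (WithTop.coe_le_coe.2 hn)
  filter_upwards [h2.eventually (by simp)] with y hy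
  ext w
  rw [fderiv_dirDeriv_apply v w
    ((hy.fderiv_right (m := 1) (by norm_num)).differentiableAt (by simp))]
  exact hy.isSymmSndFDerivAt (by simp) w v

theorem fderiv_fderiv_dirDeriv_dirDeriv {f : E → G} {x : E} (v : E) (hf : ContDiffAt ℝ 4 f x) :
    fderiv ℝ (fderiv ℝ (dirDeriv v (dirDeriv v f))) x =
      dirDeriv v (dirDeriv v (fderiv ℝ (fderiv ℝ f))) x := by
  have hf4 : ContDiffAt ℝ (4 : ℕ∞) f x := hf
  have hD : ContDiffAt ℝ (3 : ℕ∞) (fderiv ℝ f) x := hf.fderiv_right (by norm_num)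
  have h1 : fderiv ℝ (dirDeriv v (dirDeriv v f)) =ᶠ[nhds x]
      dirDeriv v (dirDeriv v (fderiv ℝ f)) :=
    (fderiv_dirDeriv_eventuallyEq v (hf4.dirDeriv (m := 3) v (by norm_num)) (by norm_num)).trans
      ((fderiv_dirDeriv_eventuallyEq v hf4 (by norm_num)).dirDeriv v)
  have h2 : fderiv ℝ (dirDeriv v (dirDeriv v (fderiv ℝ f))) =ᶠ[nhds x]
      dirDeriv v (dirDeriv v (fderiv ℝ (fderiv ℝ f))) :=
    (fderiv_dirDeriv_eventuallyEq v (hD.dirDeriv (m := 2) v (by norm_num)) (by norm_num)).trans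
      ((fderiv_dirDeriv_eventuallyEq v hD (by norm_num)).dirDeriv v)
  exact h1.fderiv_eq.trans h2.eq_of_nhds

theorem iteratedFDeriv_two_eq_dirDeriv {f : E → G} {x : E} (v : E) (hf : ContDiffAt ℝ 2 f x) :
    iteratedFDeriv ℝ 2 f x ![v, v] = dirDeriv v (dirDeriv v f) x := by
  rw [iteratedFDeriv_two_apply, dirDeriv, fderiv_dirDeriv_apply v v
    ((hf.fderiv_right (m := 1) (by norm_num)).differentiableAt (by simp))]
  simp

/-- Second order central differences converge to the second directional derivative. -/
theorem eventually_norm_second_difference_sub_le {f : E → G} {x : E} (v : E)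
    (hf : ContDiffAt ℝ 2 f x) {ε : ℝ} (hε : 0 < ε) :
    ∀ᶠ t : ℝ in nhds 0,
      ‖f (x + t • v) + f (x - t • v) - (2 : ℝ) • f x
        - t ^ 2 • dirDeriv v (dirDeriv v f) x‖ ≤ ε * t ^ 2 := by
  set c := dirDeriv v (dirDeriv v f) x with hc
  have hplus : ∀ t : ℝ, HasDerivAt (fun t : ℝ => x + t • v) v t := fun t => by
    simpa using ((hasDerivAt_id t).smul_const v).const_add x
  have hminus : ∀ t : ℝ, HasDerivAt (fun t : ℝ => x - t • v) (-v) t := fun t => by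
    simpa using ((hasDerivAt_id t).smul_const v).const_sub x
  have tplus : Filter.Tendsto (fun t : ℝ => x + t • v) (nhds 0) (nhds x) := by
    simpa using (hplus 0).continuousAt.tendsto
  have tminus : Filter.Tendsto (fun t : ℝ => x - t • v) (nhds 0) (nhds x) := by
    simpa using (hminus 0).continuousAt.tendsto
  have hev : ∀ᶠ y in nhds x, DifferentiableAt ℝ f y :=
    (hf.eventually (by simp)).mono fun y hy => hy.differentiableAt (by simp)
  obtain ⟨r, hr, hball⟩ := Metric.eventually_nhds_iff_ball.1
    ((tplus.eventually hev).and (tminus.eventually hev))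
  have hder : ∀ t ∈ Metric.ball (0 : ℝ) r, HasDerivWithinAt
      (fun t : ℝ => f (x + t • v) + f (x - t • v) - (2 : ℝ) • f x - t ^ 2 • c)
      (dirDeriv v f (x + t • v) - dirDeriv v f (x - t • v) - (2 * t) • c)
      (Metric.ball 0 r) t := by
    intro t ht
    have h1 := (hball t ht).1.hasFDerivAt.comp_hasDerivAt t (hplus t)
    have h2 := (hball t ht).2.hasFDerivAt.comp_hasDerivAt t (hminus t)
    have h3 : HasDerivAt (fun t : ℝ => t ^ 2 • c) ((2 * t) • c) t := by
      simpa using (hasDerivAt_pow 2 t).smul_const c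
    have h4 := ((h1.add h2).sub_const ((2 : ℝ) • f x)).sub h3
    refine HasDerivAt.hasDerivWithinAt (h4.congr_deriv ?_)
    simp [dirDeriv, sub_eq_add_neg]
  have hg : DifferentiableAt ℝ (dirDeriv v f) x :=
    (ContDiffAt.dirDeriv (m := 1) (n := 2) v hf (by norm_num)).differentiableAt (by simp)
  have hg' : (fun t : ℝ => dirDeriv v f (x + t • v) - dirDeriv v f (x - t • v) - (2 * t) • c)
      =o[nhds 0] fun t : ℝ => (t - 0) ^ 1 := by
    have hgp : HasFDerivAt (dirDeriv v f) (fderiv ℝ (dirDeriv v f) x) (x + (0 : ℝ) • v) := by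
      simpa using hg.hasFDerivAt
    have hgm : HasFDerivAt (dirDeriv v f) (fderiv ℝ (dirDeriv v f) x) (x - (0 : ℝ) • v) := by
      simpa using hg.hasFDerivAt
    have h1 := hgp.comp_hasDerivAt (0 : ℝ) (hplus 0)
    have h2 := hgm.comp_hasDerivAt (0 : ℝ) (hminus 0)
    have h3 := (h1.sub h2).isLittleO
    refine h3.congr (fun t => ?_) (fun t => by simp)
    have hcv : fderiv ℝ (dirDeriv v f) x v = c := rfl
    simp [hcv]
    module
  have key := Convex.isLittleO_pow_succ_real (convex_ball (0 : ℝ) r) (Metric.mem_ball_self hr)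
    hder (hg'.mono nhdsWithin_le_nhds)
  rw [nhdsWithin_eq_nhds.2 (Metric.ball_mem_nhds 0 hr)] at key
  filter_upwards [key.def hε] with t ht
  have h0 : f x + f x - (2 : ℝ) • f x = 0 := by rw [two_smul, sub_self]
  simpa [h0] using ht

theorem fderiv_fderiv_apply_self_nonneg_of_isLocalMin {f : E → ℝ} {x : E}
    (hf : ContDiffAt ℝ 2 f x) (hmin : IsLocalMin f x) (v : E) :
    0 ≤ fderiv ℝ (fderiv ℝ f) x v v := by
  have hc : fderiv ℝ (fderiv ℝ f) x v v = dirDeriv v (dirDeriv v f) x :=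
    (fderiv_dirDeriv_apply v v
      ((hf.fderiv_right (m := 1) (by norm_num)).differentiableAt (by simp))).symm
  rw [hc]
  refine le_of_forall_pos_le_add fun ε hε => ?_
  have tplus : Filter.Tendsto (fun t : ℝ => x + t • v) (nhds 0) (nhds x) :=
    Continuous.tendsto' (by fun_prop) _ _ (by simp)
  have tminus : Filter.Tendsto (fun t : ℝ => x - t • v) (nhds 0) (nhds x) :=
    Continuous.tendsto' (by fun_prop) _ _ (by simp)
  have hev := (((eventually_norm_second_difference_sub_le v hf hε).and
    (tplus.eventually hmin)).and (tminus.eventually hmin)).filter_mono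
      (nhdsWithin_le_nhds (s := {(0 : ℝ)}ᶜ))
  obtain ⟨t, ⟨⟨h1, h2⟩, h3⟩, ht⟩ := (hev.and self_mem_nhdsWithin).exists
  have ht2 : 0 < t ^ 2 := by
    have : t ≠ 0 := ht
    positivity
  rw [Real.norm_eq_abs, abs_le] at h1
  simp only [smul_eq_mul] at h1
  have : 0 ≤ t ^ 2 * (dirDeriv v (dirDeriv v f) x + ε) := by linarith [h1.2]
  exact nonneg_of_mul_nonneg_right this ht2

end DirectionalDerivative

theorem ConcaveOn.le_add_deriv_mul_sub {f : ℝ → ℝ} (hf : ConcaveOn ℝ univ f)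
    {x : ℝ} (hd : DifferentiableAt ℝ f x) (y : ℝ) : f y ≤ f x + deriv f x * (y - x) := by
  rcases lt_trichotomy x y with h | rfl | h
  · have := hf.slope_le_of_hasDerivAt (mem_univ x) (mem_univ y) h hd.hasDerivAt
    rw [slope_def_field, div_le_iff₀ (by linarith)] at this
    linarith
  · simp
  · have := hf.le_slope_of_hasDerivAt (mem_univ y) (mem_univ x) h hd.hasDerivAt
    rw [slope_def_field, le_div_iff₀ (by linarith)] at this
    linarith

theorem opNorm_smul {n : ℕ} (c : ℝ) (A : Matrix (Fin n) (Fin n) ℝ) :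
    opNorm (c • A) = |c| * opNorm A := by
  rw [opNorm, opNorm, map_smul, norm_smul, Real.norm_eq_abs]

/-- The matrix of a bilinear form on `ℝⁿ` in the standard basis. -/
def bilinMatrix {n : ℕ} (B : Euc n →L[ℝ] Euc n →L[ℝ] ℝ) : Matrix (Fin n) (Fin n) ℝ :=
  Matrix.of fun i j => B (EuclideanSpace.single i 1) (EuclideanSpace.single j 1)

theorem hess2_eq_bilinMatrix {n : ℕ} (u : Euc n → ℝ) (x : Euc n) :
    hess2 u x = bilinMatrix (fderiv ℝ (fderiv ℝ u) x) := by
  ext i j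
  simp [hess2, bilinMatrix, iteratedFDeriv_two_apply]

theorem bilinMatrix_isSymm {n : ℕ} {B : Euc n →L[ℝ] Euc n →L[ℝ] ℝ}
    (hB : ∀ v w, B v w = B w v) : (bilinMatrix B).IsSymm :=
  Matrix.IsSymm.ext fun _ _ => hB _ _

theorem dotProduct_bilinMatrix_mulVec {n : ℕ} (B : Euc n →L[ℝ] Euc n →L[ℝ] ℝ) (ξ : Euc n) :
    (fun i => ξ i) ⬝ᵥ (bilinMatrix B).mulVec (fun i => ξ i) = B ξ ξ := by
  have hξ : ξ = ∑ i, ξ i • EuclideanSpace.single i (1 : ℝ) := by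
    ext j
    simp [Finset.sum_apply, Pi.single_apply]
  conv_rhs => rw [hξ]
  simp only [map_sum, map_smul, sum_apply, smul_apply,
    smul_eq_mul, dotProduct, Matrix.mulVec, bilinMatrix, Matrix.of_apply, Finset.mul_sum]
  rw [Finset.sum_comm]
  refine Finset.sum_congr rfl fun i _ => Finset.sum_congr rfl fun j _ => ?_
  ring

theorem posSemidef_bilinMatrix_add_smul_one {n : ℕ} {B : Euc n →L[ℝ] Euc n →L[ℝ] ℝ}
    (hB : ∀ v w, B v w = B w v) {δ : ℝ} (h : ∀ ξ, -δ * ‖ξ‖ ^ 2 ≤ B ξ ξ) :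
    (bilinMatrix B + δ • (1 : Matrix (Fin n) (Fin n) ℝ)).PosSemidef := by
  refine Matrix.PosSemidef.of_dotProduct_mulVec_nonneg ?_ fun x => ?_
  · have : (bilinMatrix B + δ • (1 : Matrix (Fin n) (Fin n) ℝ)).IsSymm :=
      (bilinMatrix_isSymm hB).add (Matrix.isSymm_one.smul δ)
    rw [Matrix.IsHermitian, Matrix.conjTranspose_eq_transpose_of_trivial]
    exact this
  · have h1 := dotProduct_bilinMatrix_mulVec B (WithLp.toLp 2 x)
    have h2 := h (WithLp.toLp 2 x)
    rw [EuclideanSpace.real_norm_sq_eq] at h2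
    have h3 : x ⬝ᵥ x = ∑ i, x i ^ 2 := by simp [dotProduct, sq]
    simp only [star_trivial, Matrix.add_mulVec, Matrix.smul_mulVec, Matrix.one_mulVec,
      dotProduct_add, dotProduct_smul, smul_eq_mul, h3]
    simp only at h1 h2
    rw [h1]
    linarith

/-- For a convex elliptic operator, an almost nonnegative second difference of symmetric matrices
gives an almost nonnegative second difference of the values of the operator. -/
theorem UniformlyElliptic.le_add_of_second_difference {n : ℕ}
    {F : Matrix (Fin n) (Fin n) ℝ → ℝ} {lb ub : ℝ} (hlb : 0 ≤ lb)
    (hF : UniformlyElliptic F lb ub)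
    (hconv : ConvexOn ℝ {A : Matrix (Fin n) (Fin n) ℝ | A.IsSymm} F)
    {B B₁ B₂ : Euc n →L[ℝ] Euc n →L[ℝ] ℝ} (hB : ∀ v w, B v w = B w v)
    (hB₁ : ∀ v w, B₁ v w = B₁ w v) (hB₂ : ∀ v w, B₂ v w = B₂ w v) {δ : ℝ} (hδ : 0 ≤ δ)
    (h : ∀ ξ, -(2 * δ) * ‖ξ‖ ^ 2 ≤ (B₁ + B₂ - (2 : ℝ) • B) ξ ξ) :
    2 * F (bilinMatrix B) - 2 * δ * (ub * opNorm (1 : Matrix (Fin n) (Fin n) ℝ)) ≤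
      F (bilinMatrix B₁) + F (bilinMatrix B₂) := by
  set D := (1 / 2 : ℝ) • (B₁ + B₂ - (2 : ℝ) • B) with hD
  set A := (1 / 2 : ℝ) • bilinMatrix B₁ + (1 / 2 : ℝ) • bilinMatrix B₂ with hA
  have hP : (bilinMatrix D + δ • (1 : Matrix (Fin n) (Fin n) ℝ)).PosSemidef := by
    refine posSemidef_bilinMatrix_add_smul_one (fun v w => ?_) fun ξ => ?_
    · simp [hD, hB v w, hB₁ v w, hB₂ v w]
    · have := h ξ
      rw [hD, smul_apply, smul_apply, smul_eq_mul]
      linarith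
  have hI : (δ • (1 : Matrix (Fin n) (Fin n) ℝ)).PosSemidef := Matrix.PosSemidef.one.smul hδ
  have hAs : A.IsSymm :=
    ((bilinMatrix_isSymm hB₁).smul _).add ((bilinMatrix_isSymm hB₂).smul _)
  have hsum : bilinMatrix B + (bilinMatrix D + δ • (1 : Matrix (Fin n) (Fin n) ℝ)) =
      A + δ • (1 : Matrix (Fin n) (Fin n) ℝ) := by
    ext i j
    simp [hA, hD, bilinMatrix]
    ring
  have h1 := (hF _ _ (bilinMatrix_isSymm hB) hP).1
  have h2 := (hF _ _ hAs hI).2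
  rw [hsum] at h1
  rw [opNorm_smul, abs_of_nonneg hδ] at h2
  have h3 : 0 ≤ lb * opNorm (bilinMatrix D + δ • (1 : Matrix (Fin n) (Fin n) ℝ)) :=
    mul_nonneg hlb (norm_nonneg _)
  have h4 := hconv.2 (bilinMatrix_isSymm hB₁) (bilinMatrix_isSymm hB₂)
    (by norm_num : (0 : ℝ) ≤ 1 / 2) (by norm_num : (0 : ℝ) ≤ 1 / 2) (by norm_num)
  rw [← hA, smul_eq_mul, smul_eq_mul] at h4
  linarith

/-- Minimum principle for pure second derivatives of solutions of the
penalized problem with a convex operator: `inf_Ω u_ττ ≥ min{inf_{∂Ω} u_ττ, −c₀}`. -/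
theorem penalized_second_derivative_minimum_principle
    (n : ℕ) (lb ub c₀ : ℝ) (hlb : 0 < lb) (hle : lb ≤ ub) (hc₀ : 0 ≤ c₀)
    (F : Matrix (Fin n) (Fin n) ℝ → ℝ) (hF : UniformlyElliptic F lb ub)
    (hFsm : ContDiffOn ℝ 2 F {A : Matrix (Fin n) (Fin n) ℝ | A.IsSymm})
    (hFconv : ConvexOn ℝ {A : Matrix (Fin n) (Fin n) ℝ | A.IsSymm} F)
    (Ω : Set (Euc n)) (hΩo : IsOpen Ω) (hΩb : Bornology.IsBounded Ω)
    (ψ : Euc n → ℝ) (hψ2 : ∀ x ∈ Ω, ContDiffAt ℝ 2 ψ x)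
    (hψsc : ∀ x ∈ Ω, ∀ τ : Euc n, ‖τ‖ = 1 → -c₀ ≤ iteratedFDeriv ℝ 2 ψ x ![τ, τ])
    (β : ℝ → ℝ) (hβ : ContDiff ℝ 2 β)
    (hβ' : ∀ t : ℝ, 0 < deriv β t) (hβ'' : ∀ t : ℝ, deriv (deriv β) t ≤ 0)
    (u : Euc n → ℝ)
    (hu4 : ∀ x ∈ Ω, ContDiffAt ℝ 4 u x)
    (huc : ContinuousOn u (closure Ω))
    (hu2c : ContinuousOn (fun x => iteratedFDeriv ℝ 2 u x) (closure Ω))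
    (hpde : ∀ x ∈ Ω, F (hess2 u x) = β (u x - ψ x)) :
    ∀ τ : Euc n, ‖τ‖ = 1 → ∀ b : ℝ,
      (∀ y ∈ frontier Ω, b ≤ iteratedFDeriv ℝ 2 u y ![τ, τ]) →
      ∀ x ∈ Ω, min b (-c₀) ≤ iteratedFDeriv ℝ 2 u x ![τ, τ] := by
  intro τ hτ b hb x hx
  by_contra! hlt
  have hev : ∀ y ∈ Ω, iteratedFDeriv ℝ 2 u y ![τ, τ] = dirDeriv τ (dirDeriv τ u) y :=
    fun y hy => iteratedFDeriv_two_eq_dirDeriv τ ((hu4 y hy).of_le (by norm_num))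
  have hcont : ContinuousOn (fun y => iteratedFDeriv ℝ 2 u y ![τ, τ]) (closure Ω) :=
    (ContinuousMultilinearMap.apply ℝ (fun _ : Fin 2 => Euc n) ℝ
      ![τ, τ]).continuous.comp_continuousOn hu2c
  obtain ⟨z, hzc, hzmin⟩ := hΩb.isCompact_closure.exists_isMinOn ⟨x, subset_closure hx⟩ hcont
  have hzx : iteratedFDeriv ℝ 2 u z ![τ, τ] ≤ iteratedFDeriv ℝ 2 u x ![τ, τ] :=
    hzmin (subset_closure hx)
  obtain ⟨hxb, hxc⟩ := lt_min_iff.1 hlt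
  have hz : z ∈ Ω := by
    by_contra hzn
    have := hb z (by rw [hΩo.frontier_eq]; exact ⟨hzc, hzn⟩)
    linarith
  have huz := hu4 z hz
  have huz2 : ContDiffAt ℝ 2 u z := huz.of_le (by norm_num)
  have hU : ContDiffAt ℝ 2 (fderiv ℝ (fderiv ℝ u)) z :=
    (huz.fderiv_right (m := 3) (by norm_num)).fderiv_right (by norm_num)
  have hsymm : ∀ y ∈ Ω, ∀ v w, fderiv ℝ (fderiv ℝ u) y v w = fderiv ℝ (fderiv ℝ u) y w v :=
    fun y hy v w => ((hu4 y hy).of_le (by norm_num) : ContDiffAt ℝ 2 u y).isSymmSndFDerivAt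
      (by simp) v w
  have hWmin : IsLocalMin (dirDeriv τ (dirDeriv τ u)) z := by
    filter_upwards [hΩo.mem_nhds hz] with y hy
    rw [← hev z hz, ← hev y hy]
    exact hzmin (subset_closure hy)
  have hW : ContDiffAt ℝ 2 (dirDeriv τ (dirDeriv τ u)) z :=
    ContDiffAt.dirDeriv (m := 2) (n := 3) τ
      (ContDiffAt.dirDeriv (m := 3) (n := 4) τ huz (by norm_num)) (by norm_num)
  have hnonneg : ∀ ξ, 0 ≤ dirDeriv τ (dirDeriv τ (fderiv ℝ (fderiv ℝ u))) z ξ ξ := fun ξ => by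
    rw [← fderiv_fderiv_dirDeriv_dirDeriv τ huz]
    exact fderiv_fderiv_apply_self_nonneg_of_isLocalMin hW hWmin ξ
  have hV : ContDiffAt ℝ 2 (u - ψ) z := huz2.sub (hψ2 z hz)
  have hVneg : dirDeriv τ (dirDeriv τ (u - ψ)) z < 0 := by
    rw [← iteratedFDeriv_two_eq_dirDeriv τ hV, iteratedFDeriv_sub_apply huz2 (hψ2 z hz),
      sub_apply]
    linarith [hψsc z hz τ hτ]
  set V'' := dirDeriv τ (dirDeriv τ (u - ψ)) z
  set b' := deriv β (u z - ψ z) with hb'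
  have hb'pos : 0 < b' := hβ' _
  set K := ub * opNorm (1 : Matrix (Fin n) (Fin n) ℝ)
  have hK : 0 ≤ K := mul_nonneg (hlb.le.trans hle) (norm_nonneg _)
  have hconc : ConcaveOn ℝ univ β :=
    concaveOn_univ_of_deriv2_nonpos (hβ.differentiable (by simp))
      ((hβ.deriv' (n := 1)).differentiable (by simp)) hβ''
  obtain ⟨ε, hε, hεlt⟩ : ∃ ε : ℝ, 0 < ε ∧ (K + b') * ε < b' * -V'' := by
    refine ⟨b' * -V'' / (2 * (K + b')), ?_, ?_⟩
    · have := neg_pos.2 hVneg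
      positivity
    · have h1 : 0 < K + b' := by positivity
      have h2 : 0 < b' * -V'' := mul_pos hb'pos (neg_pos.2 hVneg)
      have h3 : (K + b') * (b' * -V'' / (2 * (K + b'))) = b' * -V'' / 2 := by field_simp
      linarith
  have tplus : Filter.Tendsto (fun t : ℝ => z + t • τ) (nhds 0) (nhds z) :=
    Continuous.tendsto' (by fun_prop) _ _ (by simp)
  have tminus : Filter.Tendsto (fun t : ℝ => z - t • τ) (nhds 0) (nhds z) :=
    Continuous.tendsto' (by fun_prop) _ _ (by simp)
  have hall := ((((eventually_norm_second_difference_sub_le τ hU hε).and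
    (eventually_norm_second_difference_sub_le τ hV hε)).and
    (tplus.eventually (hΩo.mem_nhds hz))).and
    (tminus.eventually (hΩo.mem_nhds hz))).filter_mono
      (nhdsWithin_le_nhds (s := {(0 : ℝ)}ᶜ))
  obtain ⟨t, ⟨⟨⟨hUt, hVt⟩, hp⟩, hm⟩, ht⟩ := (hall.and self_mem_nhdsWithin).exists
  have ht2 : 0 < t ^ 2 := by
    have : t ≠ 0 := ht
    positivity
  have hF2 := hF.le_add_of_second_difference hlb.le hFconv (hsymm z hz) (hsymm _ hp)
    (hsymm _ hm) (δ := ε * t ^ 2 / 2) (by positivity) fun ξ => by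
      set R := fderiv ℝ (fderiv ℝ u) (z + t • τ) + fderiv ℝ (fderiv ℝ u) (z - t • τ)
        - (2 : ℝ) • fderiv ℝ (fderiv ℝ u) z with hR
      set Q := dirDeriv τ (dirDeriv τ (fderiv ℝ (fderiv ℝ u))) z
      have h1 : ‖(R - t ^ 2 • Q) ξ ξ‖ ≤ ε * t ^ 2 * ‖ξ‖ * ‖ξ‖ :=
        ((R - t ^ 2 • Q).le_opNorm₂ ξ ξ).trans (by gcongr)
      rw [Real.norm_eq_abs, abs_le] at h1
      simp only [sub_apply, smul_apply, smul_eq_mul] at h1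
      have h2 := mul_nonneg ht2.le (hnonneg ξ)
      linarith [h1.1]
  simp only [← hess2_eq_bilinMatrix] at hF2
  rw [hpde _ hz, hpde _ hp, hpde _ hm] at hF2
  have hβd : DifferentiableAt ℝ β (u z - ψ z) := hβ.differentiable (by simp) _
  have hβp := hconc.le_add_deriv_mul_sub hβd (u (z + t • τ) - ψ (z + t • τ))
  have hβm := hconc.le_add_deriv_mul_sub hβd (u (z - t • τ) - ψ (z - t • τ))
  rw [← hb'] at hβp hβm
  rw [Real.norm_eq_abs, abs_le] at hVt
  simp only [Pi.sub_apply, smul_eq_mul] at hVt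
  have h5 := mul_le_mul_of_nonneg_left hVt.2 hb'pos.le
  have h6 := mul_lt_mul_of_pos_left hεlt ht2
  linarith
end
end
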